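/- (Nonconflictingness is preserved under projection to the coordinator alphabet, step in the proof of Lemma 1.) Let Σ₁, Σ₂ ⊆ Σ and let Σ_k be a subalphabet with Σ₁ ∩ Σ₂ ⊆ Σ_k ⊆ Σ₁ ∪ Σ₂; write P_k for the natural projection onto Σ_k. Let M₁ be a language over Σ₁ ∪ Σ_k and M₂ a language over Σ₂ ∪ Σ_k, and assume M₁ and M₂ are synchronously nonconflicting, i.e., cl(M₁ ∥ M₂) = cl(M₁) ∥ cl(M₂). Then M₁ and P_k(M₂) are synchronously nonconflicting: cl(M₁ ∥ P_k(M₂)) = cl(M₁) ∥ cl(P_k(M₂)). -/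

import Mathlib

namespace CoordControl

variable {α : Type*}

/-- Natural projection onto subalphabet `A`: erase all letters outside `A`. -/
noncomputable def proj (A : Set α) (w : List α) : List α :=
  w.filter fun a => @decide (a ∈ A) (Classical.dec _)

/-- Projection of a language. -/
noncomputable def projL (A : Set α) (L : Set (List α)) : Set (List α) :=
  proj A '' L

/-- A word is over alphabet `A`. -/
def WordOver (A : Set α) (w : List α) : Prop := ∀ a ∈ w, a ∈ A

/-- A language is over alphabet `A`. -/
def LangOver (A : Set α) (L : Set (List α)) : Prop := ∀ w ∈ L, WordOver A w

/-- Synchronous product of `L₁` over `A₁` and `L₂` over `A₂`. -/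
def sync (A₁ A₂ : Set α) (L₁ L₂ : Set (List α)) : Set (List α) :=
  {w | WordOver (A₁ ∪ A₂) w ∧ proj A₁ w ∈ L₁ ∧ proj A₂ w ∈ L₂}

/-- Prefix closure. -/
def cl (L : Set (List α)) : Set (List α) := {w | ∃ u, w ++ u ∈ L}

/-- A language is prefix-closed if it equals its prefix closure. -/
def PrefixClosed (L : Set (List α)) : Prop := L = cl L

/-- `K` is controllable with respect to `L` and the uncontrollable events `U`. -/
def Controllable (K L : Set (List α)) (U : Set α) : Prop :=
  ∀ w ∈ cl K, ∀ a ∈ U, w ++ [a] ∈ L → w ++ [a] ∈ cl K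

/-- Supremal controllable sublanguage of `K` w.r.t. `L` and `U`. -/
def supC (K L : Set (List α)) (U : Set α) : Set (List α) :=
  ⋃₀ {M | M ⊆ K ∧ Controllable M L U}

/-- Infimal prefix-closed controllable superlanguage of `K` w.r.t. `L` and `U`. -/
def infC (K L : Set (List α)) (U : Set α) : Set (List α) :=
  ⋂₀ {M | K ⊆ M ∧ PrefixClosed M ∧ Controllable M L U}

/-- `M` over `A₁` and `N` over `A₂` are synchronously nonconflicting. -/
def Nonconflicting (A₁ A₂ : Set α) (M N : Set (List α)) : Prop :=
  cl (sync A₁ A₂ M N) = sync A₁ A₂ (cl M) (cl N)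

/-- The natural projection onto `A` is an `L`-observer. -/
def Observer (A : Set α) (L : Set (List α)) : Prop :=
  ∀ t ∈ projL A L, ∀ s ∈ cl L, proj A s <+: t →
    ∃ u, s ++ u ∈ L ∧ proj A (s ++ u) = t

/-- The natural projection onto `A` is locally control consistent (LCC) for `L`,
with uncontrollable events `U`. -/
def LCC (A U : Set α) (L : Set (List α)) : Prop :=
  ∀ s ∈ cl L, ∀ σ ∈ U ∩ A,
    (∃ u, WordOver Aᶜ u ∧ s ++ u ++ [σ] ∈ cl L) →
    ∃ u', WordOver (Aᶜ ∩ U) u' ∧ s ++ u' ++ [σ] ∈ cl L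

/-- The coordinator `L_k = P_k(L₁) ∥ P_k(L₂)`. -/
noncomputable def coord (Ek : Set α) (L₁ L₂ : Set (List α)) : Set (List α) :=
  sync Ek Ek (projL Ek L₁) (projL Ek L₂)

/-- `K` is conditionally decomposable w.r.t. `(E₁, E₂, Ek)`. -/
noncomputable def CondDecomposable (E₁ E₂ Ek : Set α) (K : Set (List α)) : Prop :=
  K = sync (E₁ ∪ Ek) (E₂ ∪ Ek) (projL (E₁ ∪ Ek) K) (projL (E₂ ∪ Ek) K)

/-- A pair `(M₁, M₂)` is a solution of Problem 1 for the specification `K`: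
`M₁` is over `E₁ ∪ Ek`, `M₂` over `E₂ ∪ Ek`, `cl Mᵢ ⊆ Lᵢ ∥ L_k`, `cl Mᵢ` is
controllable w.r.t. `Lᵢ ∥ L_k` and `Σ_{i+k,u}`, and `M₁ ∥ M₂ = K`,
`cl M₁ ∥ cl M₂ = cl K`. -/
noncomputable def IsSolution (E₁ E₂ Ek U : Set α) (L₁ L₂ K M₁ M₂ : Set (List α)) : Prop :=
  LangOver (E₁ ∪ Ek) M₁ ∧ LangOver (E₂ ∪ Ek) M₂ ∧
  cl M₁ ⊆ sync E₁ Ek L₁ (coord Ek L₁ L₂) ∧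
  cl M₂ ⊆ sync E₂ Ek L₂ (coord Ek L₁ L₂) ∧
  Controllable (cl M₁) (sync E₁ Ek L₁ (coord Ek L₁ L₂)) ((E₁ ∪ Ek) ∩ U) ∧
  Controllable (cl M₂) (sync E₂ Ek L₂ (coord Ek L₁ L₂)) ((E₂ ∪ Ek) ∩ U) ∧
  sync (E₁ ∪ Ek) (E₂ ∪ Ek) M₁ M₂ = K ∧
  sync (E₁ ∪ Ek) (E₂ ∪ Ek) (cl M₁) (cl M₂) = cl K

/-- `M` is relaxed conditionally controllable w.r.t. plants `L₁`, `L₂` and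
coordinator `Lk`. -/
noncomputable def RelaxedCC (E₁ E₂ Ek U : Set α) (L₁ L₂ Lk M : Set (List α)) : Prop :=
  Controllable (projL (E₁ ∪ Ek) M) (sync E₁ Ek L₁ Lk) ((E₁ ∪ Ek) ∩ U) ∧
  Controllable (projL (E₂ ∪ Ek) M) (sync E₂ Ek L₂ Lk) ((E₂ ∪ Ek) ∩ U)

/-- `M` is conditionally controllable (original framework) w.r.t. plants `L₁`, `L₂`
and coordinator `Lk`. -/
noncomputable def CondControllable (E₁ E₂ Ek U : Set α) (L₁ L₂ Lk M : Set (List α)) : Prop :=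
  Controllable (projL Ek M) Lk (Ek ∩ U) ∧
  Controllable (projL (E₁ ∪ Ek) M) (sync E₁ Ek L₁ (cl (projL Ek M))) ((E₁ ∪ Ek) ∩ U) ∧
  Controllable (projL (E₂ ∪ Ek) M) (sync E₂ Ek L₂ (cl (projL Ek M))) ((E₂ ∪ Ek) ∩ U)

theorem proj_append (A : Set α) (u v : List α) : proj A (u ++ v) = proj A u ++ proj A v :=
  List.filter_append ..

theorem wordOver_append {A : Set α} {u v : List α} :
    WordOver A (u ++ v) ↔ WordOver A u ∧ WordOver A v := by
  simp [WordOver, or_imp, forall_and]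

theorem wordOver_proj (A : Set α) (w : List α) : WordOver A (proj A w) := by
  intro a ha
  simpa using (List.mem_filter.1 ha).2

theorem WordOver.mono {A B : Set α} (h : A ⊆ B) {w : List α} (hw : WordOver A w) :
    WordOver B w :=
  fun a ha => h (hw a ha)

theorem WordOver.proj_eq {A : Set α} {w : List α} (hw : WordOver A w) : proj A w = w :=
  List.filter_eq_self.2 fun a ha => by simpa using hw a ha

theorem proj_eq_nil {A : Set α} {w : List α} : proj A w = [] ↔ WordOver Aᶜ w := by
  simp [proj, WordOver]

theorem proj_proj (A B : Set α) (w : List α) : proj A (proj B w) = proj (A ∩ B) w := by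
  simp only [proj, List.filter_filter]
  exact List.filter_congr fun a _ => by rw [Bool.eq_iff_iff]; simp

theorem proj_cons_of_mem {A : Set α} {a : α} (h : a ∈ A) (w : List α) :
    proj A (a :: w) = a :: proj A w :=
  List.filter_cons_of_pos (by simpa using h)

theorem proj_cons_of_notMem {A : Set α} {a : α} (h : a ∉ A) (w : List α) :
    proj A (a :: w) = proj A w :=
  List.filter_cons_of_neg (by simpa using h)

/-- Two words with the same projection onto the shared alphabet have a common interleaving. -/
theorem exists_proj_eq_and_proj_eq {A B : Set α} {w m : List α}
    (hw : WordOver A w) (hm : WordOver B m) (h : proj (A ∩ B) w = proj (A ∩ B) m) :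
    ∃ x, WordOver (A ∪ B) x ∧ proj A x = w ∧ proj B x = m := by
  induction w generalizing m with
  | nil =>
    have hc : WordOver (A ∩ B)ᶜ m := proj_eq_nil.1 h.symm
    exact ⟨m, hm.mono Set.subset_union_right,
      proj_eq_nil.2 fun a ha haA => hc a ha ⟨haA, hm a ha⟩, hm.proj_eq⟩
  | cons a w ih =>
    have haA : a ∈ A := hw a (by simp)
    have hw' : WordOver A w := fun b hb => hw b (by simp [hb])
    by_cases haB : a ∈ B
    · rw [proj_cons_of_mem (show a ∈ A ∩ B from ⟨haA, haB⟩)] at h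
      obtain ⟨l, r, rfl, hl, -, hr⟩ := List.filter_eq_cons_iff.1 h.symm
      obtain ⟨hlB, harB⟩ := wordOver_append.1 hm
      have hrB : WordOver B r := fun b hb => harB b (by simp [hb])
      obtain ⟨x, hx, hxA, hxB⟩ := ih hw' hrB hr.symm
      have hlA : proj A l = [] :=
        proj_eq_nil.2 fun b hb hbA => hl b hb (by simpa using ⟨hbA, hlB b hb⟩)
      refine ⟨l ++ a :: x, wordOver_append.2 ⟨hlB.mono Set.subset_union_right, ?_⟩, ?_, ?_⟩
      · exact List.forall_mem_cons.2 ⟨Or.inl haA, hx⟩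
      · rw [proj_append, hlA, proj_cons_of_mem haA, hxA, List.nil_append]
      · rw [proj_append, hlB.proj_eq, proj_cons_of_mem haB, hxB]
    · rw [proj_cons_of_notMem fun h' : a ∈ A ∩ B => haB h'.2] at h
      obtain ⟨x, hx, hxA, hxB⟩ := ih hw' hm h
      exact ⟨a :: x, List.forall_mem_cons.2 ⟨Or.inl haA, hx⟩,
        by rw [proj_cons_of_mem haA, hxA], by rw [proj_cons_of_notMem haB, hxB]⟩

theorem cl_sync_subset (A B : Set α) (M N : Set (List α)) :
    cl (sync A B M N) ⊆ sync A B (cl M) (cl N) := by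
  rintro w ⟨u, hwu, hM, hN⟩
  rw [proj_append] at hM hN
  exact ⟨(wordOver_append.1 hwu).1, ⟨_, hM⟩, ⟨_, hN⟩⟩

/-- Nonconflictingness is preserved under projection to the coordinator alphabet
(step in the proof of Lemma 1). -/
theorem nonconflicting_projection
    (E₁ E₂ Ek : Set α)
    (hInter : E₁ ∩ E₂ ⊆ Ek) (hSub : Ek ⊆ E₁ ∪ E₂)
    (M₁ M₂ : Set (List α))
    (hM1 : LangOver (E₁ ∪ Ek) M₁) (hM2 : LangOver (E₂ ∪ Ek) M₂)
    (hNC : Nonconflicting (E₁ ∪ Ek) (E₂ ∪ Ek) M₁ M₂) :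
    Nonconflicting (E₁ ∪ Ek) Ek M₁ (projL Ek M₂) := by
  have hI : (E₁ ∪ Ek) ∩ (E₂ ∪ Ek) = Ek := by
    rw [← Set.inter_union_distrib_right, Set.union_eq_right.2 hInter]
  have hU : E₁ ∪ Ek ∪ Ek = E₁ ∪ Ek := by rw [Set.union_assoc, Set.union_self]
  refine (cl_sync_subset _ _ _ _).antisymm ?_
  rintro w ⟨hw, hw₁, u, m, hm, hmu⟩
  rw [hU] at hw
  rw [hw.proj_eq] at hw₁
  obtain ⟨m₁, m₂, rfl, hm₁, -⟩ := List.filter_eq_append_iff.1 hmu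
  obtain ⟨x, hx, hxA, hxB⟩ := exists_proj_eq_and_proj_eq hw (wordOver_append.1 (hM2 _ hm)).1
    (by rw [hI]; exact hm₁.symm)
  obtain ⟨v, -, hv₁, hv₂⟩ : x ∈ cl (sync (E₁ ∪ Ek) (E₂ ∪ Ek) M₁ M₂) := by
    rw [hNC]
    exact ⟨hx, hxA ▸ hw₁, m₂, hxB ▸ hm⟩
  have hy := wordOver_proj (E₁ ∪ Ek) (x ++ v)
  refine ⟨proj (E₁ ∪ Ek) v, ?_⟩
  rw [← hxA, ← proj_append]
  refine ⟨hy.mono hU.ge, by rwa [hy.proj_eq], _, hv₂, ?_⟩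
  rw [proj_proj, proj_proj, Set.inter_eq_left.2 Set.subset_union_right,
    Set.inter_eq_left.2 Set.subset_union_right]

end CoordControl
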